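/- Let N, C be positive integers, T1 > 0, T2 > 0, and let d_{ij} > 0 (1 ≤ i ≤ N, 1 ≤ j ≤ C) be strictly positive real numbers. Then the max–min value sup over probability vectors w ∈ ℝ^N of ( inf over N×C matrices U with probability-vector rows of F(w,U) ), where F(w,U) = Σ_{i=1}^N w_i ( Σ_{j=1}^C u_{ij} log d_{ij} + T1 Σ_{j=1}^C u_{ij} log u_{ij} ) − T2 Σ_{i=1}^N w_i log w_i, equals T2 · log( Σ_{i=1}^N ( Σ_{j=1}^C d_{ij}^{−1/T1} )^{−T1/T2} ). -/

import Mathlib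

open Real Finset

/-- **Gibbs variational inequality** on a finite type. -/
theorem sum_mul_sub_sum_mul_log_le_log_sum_exp {ι : Type*} [Fintype ι] [Nonempty ι]
    (a u : ι → ℝ) (hu : ∀ i, 0 ≤ u i) (hsum : ∑ i, u i = 1) :
    ∑ i, u i * a i - ∑ i, u i * Real.log (u i) ≤ Real.log (∑ i, Real.exp (a i)) := by
  set Z := ∑ i, Real.exp (a i) with hZ
  have hZpos : 0 < Z := Finset.sum_pos (fun i _ => Real.exp_pos _) Finset.univ_nonempty
  have key : ∀ i, u i * a i - u i * Real.log (u i) - u i * Real.log Z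
      ≤ Real.exp (a i) / Z - u i := by
    intro i
    rcases (hu i).eq_or_lt with h0 | hpos
    · rw [← h0]
      have : 0 < Real.exp (a i) / Z := by positivity
      simpa using this.le
    · have h := Real.log_le_sub_one_of_pos (x := Real.exp (a i) / (Z * u i)) (by positivity)
      rw [Real.log_div (by positivity) (by positivity), Real.log_mul hZpos.ne' hpos.ne',
        Real.log_exp] at h
      calc u i * a i - u i * Real.log (u i) - u i * Real.log Z
          = u i * (a i - (Real.log Z + Real.log (u i))) := by ring
        _ ≤ u i * (Real.exp (a i) / (Z * u i) - 1) := by gcongr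
        _ = Real.exp (a i) / Z - u i := by field_simp
  have h := Finset.sum_le_sum fun i (_ : i ∈ Finset.univ) => key i
  simp only [Finset.sum_sub_distrib, ← Finset.sum_mul, ← Finset.sum_div, ← hZ, hsum,
    div_self hZpos.ne'] at h
  linarith

/-- The softmax vector attains equality in the Gibbs variational inequality. -/
theorem exists_sum_mul_sub_sum_mul_log_eq_log_sum_exp {ι : Type*} [Fintype ι] [Nonempty ι]
    (a : ι → ℝ) : ∃ u : ι → ℝ, (∀ i, 0 ≤ u i) ∧ ∑ i, u i = 1 ∧
      ∑ i, u i * a i - ∑ i, u i * Real.log (u i) = Real.log (∑ i, Real.exp (a i)) := by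
  set Z := ∑ i, Real.exp (a i) with hZ
  have hZpos : 0 < Z := Finset.sum_pos (fun i _ => Real.exp_pos _) Finset.univ_nonempty
  have hsum : ∑ i, Real.exp (a i) / Z = 1 := by
    rw [← Finset.sum_div, ← hZ, div_self hZpos.ne']
  refine ⟨fun i => Real.exp (a i) / Z, fun i => by positivity, hsum, ?_⟩
  rw [← Finset.sum_sub_distrib]
  calc ∑ i, (Real.exp (a i) / Z * a i - Real.exp (a i) / Z * Real.log (Real.exp (a i) / Z))
      = ∑ i, Real.exp (a i) / Z * Real.log Z := by
        refine Finset.sum_congr rfl fun i _ => ?_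
        rw [Real.log_div (Real.exp_pos _).ne' hZpos.ne', Real.log_exp]
        ring
    _ = Real.log Z := by rw [← Finset.sum_mul, hsum, one_mul]

/-- Rescaled form of the Gibbs variational principle: at temperature `T`, the maximal value of
`∑ u a - T ∑ u log u` over probability vectors is `T log ∑ exp (a / T)`. -/
theorem isGreatest_sum_mul_sub_mul_sum_mul_log {ι : Type*} [Fintype ι] [Nonempty ι]
    {T : ℝ} (hT : 0 < T) (a : ι → ℝ) :
    IsGreatest {v : ℝ | ∃ u : ι → ℝ, (∀ i, 0 ≤ u i) ∧ ∑ i, u i = 1 ∧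
        v = ∑ i, u i * a i - T * ∑ i, u i * Real.log (u i)}
      (T * Real.log (∑ i, Real.exp (a i / T))) := by
  have rescale : ∀ u : ι → ℝ, ∑ i, u i * a i - T * ∑ i, u i * Real.log (u i) =
      T * (∑ i, u i * (a i / T) - ∑ i, u i * Real.log (u i)) := by
    intro u
    rw [mul_sub, Finset.mul_sum Finset.univ (fun i => u i * (a i / T))]
    congr 1
    exact Finset.sum_congr rfl fun i _ => by field_simp
  constructor
  · obtain ⟨u, hu, hsum, h⟩ :=
      exists_sum_mul_sub_sum_mul_log_eq_log_sum_exp fun i => a i / T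
    exact ⟨u, hu, hsum, by rw [rescale, h]⟩
  · rintro _ ⟨u, hu, hsum, rfl⟩
    rw [rescale]
    exact mul_le_mul_of_nonneg_left
      (sum_mul_sub_sum_mul_log_le_log_sum_exp _ u hu hsum) hT.le

/-- The max–min value of the Fuzzy-ITISC objective: the supremum over probability
vectors `w` of the infimum over matrices `U` with probability-vector rows of
`F(w,U) = ∑ i, w i * (∑ j, U i j * log (d i j) + T1 * ∑ j, U i j * log (U i j))
          - T2 * ∑ i, w i * log (w i)`
equals `T2 * log (∑ i, (∑ j, d i j ^ (-1/T1)) ^ (-T1/T2))`. -/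
theorem fuzzy_itisc_maxmin_value (N C : ℕ) (hN : 0 < N) (hC : 0 < C)
    (T1 T2 : ℝ) (hT1 : 0 < T1) (hT2 : 0 < T2)
    (d : Fin N → Fin C → ℝ) (hd : ∀ i j, 0 < d i j) :
    sSup {v : ℝ | ∃ w : Fin N → ℝ, (∀ i, 0 ≤ w i) ∧ (∑ i, w i = 1) ∧
      v = sInf {r : ℝ | ∃ U : Fin N → Fin C → ℝ,
        (∀ i, (∀ j, 0 ≤ U i j) ∧ ∑ j, U i j = 1) ∧
        r = ∑ i, w i * (∑ j, U i j * Real.log (d i j)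
              + T1 * ∑ j, U i j * Real.log (U i j))
              - T2 * ∑ i, w i * Real.log (w i)}}
    = T2 * Real.log (∑ i, (∑ j, d i j ^ (-1 / T1)) ^ (-T1 / T2)) := by
  have : Nonempty (Fin N) := Fin.pos_iff_nonempty.mp hN
  have : Nonempty (Fin C) := Fin.pos_iff_nonempty.mp hC
  set S : Fin N → ℝ := fun i => ∑ j, d i j ^ (-1 / T1) with hS
  have hSpos : ∀ i, 0 < S i := fun i =>
    Finset.sum_pos (fun j _ => Real.rpow_pos_of_pos (hd i j) _) Finset.univ_nonempty
  have hSexp : ∀ i, ∑ j, Real.exp (-Real.log (d i j) / T1) = S i := fun i =>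
    Finset.sum_congr rfl fun j _ => by
      rw [Real.rpow_def_of_pos (hd i j)]
      congr 1
      ring
  have hrow := fun i => isGreatest_sum_mul_sub_mul_sum_mul_log hT1 fun j => -Real.log (d i j)
  simp only [hSexp, mul_neg, Finset.sum_neg_distrib] at hrow
  have hinner : ∀ w : Fin N → ℝ, (∀ i, 0 ≤ w i) →
      sInf {r : ℝ | ∃ U : Fin N → Fin C → ℝ,
        (∀ i, (∀ j, 0 ≤ U i j) ∧ ∑ j, U i j = 1) ∧
        r = ∑ i, w i * (∑ j, U i j * Real.log (d i j)
              + T1 * ∑ j, U i j * Real.log (U i j))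
              - T2 * ∑ i, w i * Real.log (w i)}
      = ∑ i, w i * (-(T1 * Real.log (S i))) - T2 * ∑ i, w i * Real.log (w i) := by
    intro w hw
    refine IsLeast.csInf_eq ⟨?_, ?_⟩
    · choose U hU hUsum hUval using fun i => (hrow i).1
      refine ⟨U, fun i => ⟨hU i, hUsum i⟩, ?_⟩
      congr 1
      refine Finset.sum_congr rfl fun i _ => ?_
      rw [hUval i]
      ring
    · rintro _ ⟨U, hU, rfl⟩
      gcongr with i _
      · exact hw i
      · have := (hrow i).2 ⟨U i, (hU i).1, (hU i).2, rfl⟩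
        linarith
  have hSrpow : ∀ i, Real.exp (-(T1 * Real.log (S i)) / T2) = S i ^ (-T1 / T2) := fun i => by
    rw [Real.rpow_def_of_pos (hSpos i)]
    congr 1
    ring
  have houter := isGreatest_sum_mul_sub_mul_sum_mul_log hT2 fun i => -(T1 * Real.log (S i))
  simp only [hSrpow] at houter
  rw [← houter.csSup_eq]
  congr 1
  ext v
  constructor
  · rintro ⟨w, hw, hsum, rfl⟩
    exact ⟨w, hw, hsum, hinner w hw⟩
  · rintro ⟨w, hw, hsum, rfl⟩
    exact ⟨w, hw, hsum, (hinner w hw).symm⟩
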